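/- arXiv:1205.6045 — 4 statements merged into one kernel-verified Lean document; each statement's English description precedes it below -/
import Mathlib

section
/- Let X and Y be separable metrizable topological spaces and let f : X → Y be a continuous surjection such that the image f(C) of every closed subset C of X is a constructible subset of Y. Then f is piece-wise closed, i.e. X can be written as a countable union of closed sets Zₙ such that the restriction of f to each Zₙ is a closed map onto its image. -/
open TopologicalSpace

/-- A subset of a topological space is *constructible* if it belongs to the smallest
family of subsets containing all open sets and stable under finite intersections
and complements. -/
inductive Constructible {Y : Type*} [TopologicalSpace Y] : Set Y → Prop
  | of_isOpen : ∀ {U : Set Y}, IsOpen U → Constructible U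
  | inter : ∀ {A B : Set Y}, Constructible A → Constructible B → Constructible (A ∩ B)
  | compl : ∀ {A : Set Y}, Constructible A → Constructible Aᶜ

open Set Filter Topology

/-- Closed subsets of `Z` have images that are relatively closed in the image of `Z`. -/
def ClosedOntoImage {X Y : Type*} [TopologicalSpace X] [TopologicalSpace Y]
    (f : X → Y) (Z : Set X) : Prop :=
  ∀ C : Set X, IsClosed C → C ⊆ Z → ∃ D : Set Y, IsClosed D ∧ f '' C = D ∩ f '' Z

/-- `A` is covered by countably many closed sets on each of which `f` is closed onto its image. -/
def PiecewiseClosedCover {X Y : Type*} [TopologicalSpace X] [TopologicalSpace Y]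
    (f : X → Y) (A : Set X) : Prop :=
  ∃ Z : ℕ → Set X, (∀ n, IsClosed (Z n)) ∧ A ⊆ ⋃ n, Z n ∧ ∀ n, ClosedOntoImage f (Z n)

/-- `AlternatesAt B n y`: membership in `B` alternates `n` times along iterated limits ending
at `y`. -/
def AlternatesAt {Y : Type*} [TopologicalSpace Y] (B : Set Y) : ℕ → Y → Prop
  | 0, _ => True
  | n + 1, y => ∃ᶠ z in 𝓝 y, (z ∈ B ↔ y ∉ B) ∧ AlternatesAt B n z

theorem Constructible.exists_rank {Y : Type*} [TopologicalSpace Y] {B : Set Y}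
    (hB : Constructible B) :
    ∃ (k : ℕ) (φ : Y → ℕ), (∀ y, φ y ≤ k) ∧
      ∀ y, ∀ᶠ z in 𝓝 y, φ y ≤ φ z ∧ (φ y = φ z → (y ∈ B ↔ z ∈ B)) := by
  classical
  induction hB with
  | @of_isOpen U hU =>
    refine ⟨1, fun y => if y ∈ U then 1 else 0, fun y => by dsimp only; split_ifs <;> simp,
      fun y => ?_⟩
    by_cases hy : y ∈ U
    · filter_upwards [hU.mem_nhds hy] with z hz
      simp [hy, hz]
    · refine Eventually.of_forall fun z => ?_
      by_cases hz : z ∈ U <;> simp [hy, hz]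
  | inter _ _ ihA ihB =>
    obtain ⟨k, φ, hk, hφ⟩ := ihA
    obtain ⟨l, ψ, hl, hψ⟩ := ihB
    refine ⟨k + l, fun y => φ y + ψ y, fun y => Nat.add_le_add (hk y) (hl y), fun y => ?_⟩
    filter_upwards [hφ y, hψ y] with z h₁ h₂
    refine ⟨Nat.add_le_add h₁.1 h₂.1, fun h => ?_⟩
    have e₁ := h₁.2 (by omega)
    have e₂ := h₂.2 (by omega)
    simp only [mem_inter_iff, e₁, e₂]
  | compl _ ih =>
    obtain ⟨k, φ, hk, hφ⟩ := ih
    refine ⟨k, φ, hk, fun y => (hφ y).mono fun z h => ⟨h.1, fun e => ?_⟩⟩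
    simp only [mem_compl_iff, h.2 e]

theorem Constructible.exists_not_alternatesAt {Y : Type*} [TopologicalSpace Y] {B : Set Y}
    (hB : Constructible B) : ∃ n, ∀ y, ¬ AlternatesAt B n y := by
  obtain ⟨k, φ, hk, hφ⟩ := hB.exists_rank
  have key : ∀ n y, AlternatesAt B n y → ∃ z, φ y + n ≤ φ z := by
    intro n
    induction n with
    | zero => exact fun y _ => ⟨y, le_rfl⟩
    | succ n ih =>
      intro y hy
      obtain ⟨z, ⟨hz, hzn⟩, hle, heq⟩ := (Frequently.and_eventually hy (hφ y)).exists
      obtain ⟨w, hw⟩ := ih z hzn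
      have hne : φ y ≠ φ z := fun h => by
        have := heq h
        tauto
      exact ⟨w, by omega⟩
  refine ⟨k + 1, fun y hy => ?_⟩
  obtain ⟨z, hz⟩ := key _ y hy
  have := hk z
  omega

theorem AlternatesAt.congr {Y : Type*} [TopologicalSpace Y] {A B V : Set Y} (hV : IsOpen V)
    (hAB : ∀ y ∈ V, y ∈ A ↔ y ∈ B) {n : ℕ} {y : Y} (hy : y ∈ V) (h : AlternatesAt A n y) :
    AlternatesAt B n y := by
  induction n generalizing y with
  | zero => trivial
  | succ n ih =>
    refine (Frequently.and_eventually h (hV.mem_nhds hy)).mono ?_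
    rintro z ⟨⟨hz, hzn⟩, hzV⟩
    exact ⟨by rw [← hAB z hzV, ← hAB y hy]; exact hz, ih hzV hzn⟩

theorem isClosed_union_iUnion {X : Type*} [TopologicalSpace X] {S : Set X} {C : ℕ → Set X}
    (hS : IsClosed S) (hC : ∀ j, IsClosed (C j))
    (h : ∀ z ∉ S, ∃ N ∈ 𝓝 z, ∀ᶠ j in atTop, Disjoint N (C j)) : IsClosed (S ∪ ⋃ j, C j) := by
  rw [← isOpen_compl_iff, isOpen_iff_mem_nhds]
  intro z hz
  simp only [mem_compl_iff, mem_union, mem_iUnion, not_or, not_exists] at hz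
  obtain ⟨N, hN, hev⟩ := h z hz.1
  obtain ⟨m, hm⟩ := eventually_atTop.1 hev
  have hfin : ∀ᶠ w in 𝓝 z, ∀ j ∈ Set.Iio m, w ∉ C j :=
    (eventually_all_finite (Set.finite_Iio m)).2
      fun j _ => (hC j).isOpen_compl.mem_nhds (hz.2 j)
  filter_upwards [hN, hfin, hS.isOpen_compl.mem_nhds hz.1] with w hwN hw hwS
  simp only [mem_compl_iff, mem_union, mem_iUnion, not_or, not_exists]
  refine ⟨hwS, fun j hj => ?_⟩
  rcases lt_or_ge j m with hjm | hjm
  · exact hw j hjm hj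
  · exact (disjoint_left.1 (hm j hjm)) hwN hj

theorem exists_seq_disjoint_intervals {X : Type*} (d : X → ℝ) (P : X → ℝ → Prop)
    (h : ∀ ε > 0, ∃ x, P x ε ∧ 0 < d x ∧ d x < ε) :
    ∃ (x : ℕ → X) (e : ℕ → ℝ) (V : ℕ → Set ℝ), Tendsto e atTop (𝓝 0) ∧ (∀ j, 0 < e j) ∧
      (∀ j, P (x j) (e j)) ∧ (∀ j, IsOpen (V j)) ∧ (∀ j, d (x j) ∈ V j) ∧
      (∀ j, V j ⊆ Ioo 0 (2 * e j)) ∧ ∀ i j, i ≠ j → Disjoint (V i) (V j) := by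
  have h' : ∀ ε : ℝ, ∃ x, 0 < ε → P x ε ∧ 0 < d x ∧ d x < ε := by
    intro ε
    by_cases hε : 0 < ε
    · obtain ⟨x, hx⟩ := h ε hε
      exact ⟨x, fun _ => hx⟩
    · exact ⟨(h 1 one_pos).choose, fun h => absurd h hε⟩
  choose g hg using h'
  let e : ℕ → ℝ := fun j => Nat.rec 1 (fun j r => min (1 / ((j : ℝ) + 1 + 1)) (d (g r) / 2)) j
  have he : ∀ j, e (j + 1) = min (1 / ((j : ℝ) + 1 + 1)) (d (g (e j)) / 2) := fun _ => rfl
  have hpos : ∀ j, 0 < e j := by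
    intro j
    induction j with
    | zero => exact one_pos
    | succ j ih =>
      rw [he]
      exact lt_min (by positivity) (half_pos (hg _ ih).2.1)
  have hle : ∀ j, e j ≤ 1 / ((j : ℝ) + 1) := by
    intro j
    cases j with
    | zero => simp [e]
    | succ j =>
      rw [he]
      push_cast
      exact min_le_left _ _
  have hd : ∀ j, 0 < d (g (e j)) ∧ d (g (e j)) < e j := fun j => (hg _ (hpos j)).2
  have hstep : ∀ j, d (g (e (j + 1))) < d (g (e j)) / 2 := fun j =>
    (hd (j + 1)).2.trans_le (by rw [he]; exact min_le_right _ _)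
  have hanti : Antitone fun j => d (g (e j)) :=
    antitone_nat_of_succ_le fun j => by linarith [hstep j, (hd j).1]
  have hdisj : ∀ i j, i < j →
      Disjoint (Ioo (3 / 4 * d (g (e i))) (3 / 2 * d (g (e i))))
        (Ioo (3 / 4 * d (g (e j))) (3 / 2 * d (g (e j)))) := by
    intro i j hij
    refine disjoint_left.2 fun t ht ht' => ?_
    have h₁ : d (g (e j)) ≤ d (g (e (i + 1))) := hanti hij
    linarith [hstep i, ht.1, ht'.2]
  refine ⟨fun j => g (e j), e, fun j => Ioo (3 / 4 * d (g (e j))) (3 / 2 * d (g (e j))),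
    squeeze_zero (fun j => (hpos j).le) hle tendsto_one_div_add_atTop_nhds_zero_nat, hpos,
    fun j => (hg _ (hpos j)).1, fun j => isOpen_Ioo, fun j => ?_, fun j t ht => ?_, ?_⟩
  · constructor <;> linarith [(hd j).1]
  · constructor <;> linarith [(hd j).1, (hd j).2, ht.1, ht.2]
  · intro i j hij
    rcases lt_or_gt_of_ne hij with h | h
    · exact hdisj i j h
    · exact (hdisj j i h).symm

section Cover

variable {X Y : Type*} [TopologicalSpace X] [TopologicalSpace Y] {f : X → Y}

theorem ClosedOntoImage.mono {Z Z' : Set X} (hZ : ClosedOntoImage f Z) (h : Z' ⊆ Z) :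
    ClosedOntoImage f Z' := by
  intro C hC hCZ
  obtain ⟨D, hD, hCD⟩ := hZ C hC (hCZ.trans h)
  refine ⟨D, hD, Subset.antisymm (fun y hy => ⟨(hCD ▸ hy).1, image_mono hCZ hy⟩) ?_⟩
  rintro y ⟨hyD, hy⟩
  rw [hCD]
  exact ⟨hyD, image_mono h hy⟩

theorem PiecewiseClosedCover.mono {A B : Set X} (hB : PiecewiseClosedCover f B) (h : A ⊆ B) :
    PiecewiseClosedCover f A := by
  obtain ⟨Z, hZ, hc, hg⟩ := hB
  exact ⟨Z, hZ, h.trans hc, hg⟩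

theorem PiecewiseClosedCover.iUnion {A : ℕ → Set X} (hA : ∀ n, PiecewiseClosedCover f (A n)) :
    PiecewiseClosedCover f (⋃ n, A n) := by
  choose Z hZ hc hg using hA
  refine ⟨fun n => Z n.unpair.1 n.unpair.2, fun n => hZ _ _, ?_, fun n => hg _ _⟩
  refine iUnion_subset fun n x hx => ?_
  obtain ⟨m, hm⟩ := mem_iUnion.1 (hc n hx)
  exact mem_iUnion.2 ⟨Nat.pair n m, by simpa using hm⟩

theorem ClosedOntoImage.piecewiseClosedCover {Z : Set X} (hZ : IsClosed Z)
    (h : ClosedOntoImage f Z) : PiecewiseClosedCover f Z :=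
  ⟨fun _ => Z, fun _ => hZ, fun _ hx => mem_iUnion.2 ⟨0, hx⟩, fun _ => h⟩

theorem piecewiseClosedCover_empty : PiecewiseClosedCover f (∅ : Set X) :=
  (show ClosedOntoImage f ∅ from fun C _ hC => ⟨∅, isClosed_empty, by
    simp [subset_empty_iff.1 hC]⟩).piecewiseClosedCover isClosed_empty

theorem PiecewiseClosedCover.union {A B : Set X} (hA : PiecewiseClosedCover f A)
    (hB : PiecewiseClosedCover f B) : PiecewiseClosedCover f (A ∪ B) := by
  refine (PiecewiseClosedCover.iUnion (A := fun n => if n = 0 then A else B) fun n => ?_).mono ?_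
  · split_ifs
    exacts [hA, hB]
  · rintro x (hx | hx)
    · exact mem_iUnion.2 ⟨0, by simpa using hx⟩
    · exact mem_iUnion.2 ⟨1, by simpa using hx⟩

theorem closedOntoImage_fiber [T1Space Y] (y : Y) : ClosedOntoImage f (f ⁻¹' {y}) := by
  intro C _ hCy
  refine ⟨f '' C, ?_, (inter_eq_left.2 (image_mono hCy)).symm⟩
  exact ((finite_singleton y).subset (image_subset_iff.2 hCy)).isClosed

/-- If `f` is not piece-wise closed, then it is nowhere piece-wise closed on some nonempty closed
set. -/
theorem exists_isClosed_nowhere_piecewiseClosedCover [SecondCountableTopology X]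
    (h : ¬ PiecewiseClosedCover f (univ : Set X)) :
    ∃ K : Set X, IsClosed K ∧ K.Nonempty ∧
      ∀ W, IsOpen W → (K ∩ W).Nonempty → ¬ PiecewiseClosedCover f (K ∩ W) := by
  set 𝒰 : Set (Set X) := {U | IsOpen U ∧ PiecewiseClosedCover f U}
  have hG : PiecewiseClosedCover f (⋃₀ 𝒰) := by
    obtain ⟨T, hTc, hTS, hTu⟩ := TopologicalSpace.isOpen_sUnion_countable 𝒰 fun U hU => hU.1
    rcases T.eq_empty_or_nonempty with rfl | hne
    · rw [← hTu, sUnion_empty]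
      exact piecewiseClosedCover_empty
    · obtain ⟨U, rfl⟩ := hTc.exists_eq_range hne
      rw [← hTu, sUnion_range]
      exact PiecewiseClosedCover.iUnion fun n => (hTS (mem_range_self n)).2
  refine ⟨(⋃₀ 𝒰)ᶜ, (isOpen_sUnion fun U hU => hU.1).isClosed_compl, ?_, ?_⟩
  · rw [nonempty_compl]
    exact fun he => h (he ▸ hG)
  · rintro W hW ⟨x, hxK, hxW⟩ hc
    refine hxK (mem_sUnion.2 ⟨W, ⟨hW, (hG.union hc).mono fun z hz => ?_⟩, hxW⟩)
    by_cases hz' : z ∈ ⋃₀ 𝒰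
    · exact Or.inl hz'
    · exact Or.inr ⟨hz', hz⟩

end Cover

theorem AlternatesAt.image_union_iUnion {X Y : Type*} [PseudoMetricSpace Y] {f : X → Y}
    {S : Set X} {C : ℕ → Set X} {y : Y} {V : ℕ → Set ℝ}
    (hV : ∀ j, IsOpen (V j)) (hdisj : ∀ i j, i ≠ j → Disjoint (V i) (V j))
    (hCV : ∀ j, ∀ c ∈ C j, dist (f c) y ∈ V j) {j : ℕ} (hS : ∀ s ∈ S, dist (f s) y ∉ V j)
    {p : Y} (hp : dist p y ∈ V j) :
    (p ∈ f '' (S ∪ ⋃ i, C i) ↔ p ∈ f '' C j) ∧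
      ∀ n, AlternatesAt (f '' C j) n p → AlternatesAt (f '' (S ∪ ⋃ i, C i)) n p := by
  have key : ∀ q : Y, dist q y ∈ V j → (q ∈ f '' (S ∪ ⋃ i, C i) ↔ q ∈ f '' C j) := by
    intro q hq
    constructor
    · rintro ⟨c, hc | hc, rfl⟩
      · exact absurd hq (hS c hc)
      · obtain ⟨i, hi⟩ := mem_iUnion.1 hc
        by_cases hij : i = j
        · exact ⟨c, hij ▸ hi, rfl⟩
        · exact absurd hq (disjoint_left.1 (hdisj i j hij) (hCV i c hi))
    · rintro ⟨c, hc, rfl⟩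
      exact ⟨c, Or.inr (mem_iUnion.2 ⟨j, hc⟩), rfl⟩
  exact ⟨key p hp, fun n h => h.congr
    ((hV j).preimage (f := fun q : Y => dist q y) (by fun_prop)) (fun q hq => (key q hq).symm) hp⟩

section Alternation

variable {X Y : Type*} [MetricSpace X] [MetricSpace Y] {f : X → Y} {K : Set X}

/-- Every nonempty relatively open piece of `K` contains a closed set whose image alternates `n`
times at some point of the image of the piece, not in the image of the closed set. -/
def AlternatesOutside (f : X → Y) (K : Set X) (n : ℕ) : Prop :=
  ∀ W, IsOpen W → (K ∩ W).Nonempty → ∃ x ∈ K ∩ W, ∃ C, IsClosed C ∧ C ⊆ K ∩ W ∧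
    f x ∉ f '' C ∧ AlternatesAt (f '' C) n (f x)

/-- Every neighbourhood in `K` of a point `x` of `K` contains a closed set through `x` whose image
alternates `n` times at `f x`. -/
def AlternatesInside (f : X → Y) (K : Set X) (n : ℕ) : Prop :=
  ∀ W, IsOpen W → ∀ x ∈ K ∩ W, ∃ C, IsClosed C ∧ C ⊆ K ∩ W ∧ x ∈ C ∧
    AlternatesAt (f '' C) n (f x)

theorem exists_isClosed_alternatesAt_seq (hf : Continuous f)
    (hK : ∀ W, IsOpen W → (K ∩ W).Nonempty → ¬ PiecewiseClosedCover f (K ∩ W))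
    {n : ℕ → ℕ} (hn : ∀ j, AlternatesOutside f K (n j)) {W : Set X} (hW : IsOpen W) {x : X}
    (hx : x ∈ K ∩ W) :
    ∃ C, IsClosed C ∧ C ⊆ K ∩ W ∧ x ∈ C ∧ ∃ p : ℕ → Y, Tendsto p atTop (𝓝 (f x)) ∧
      ∀ j, p j ∉ f '' C ∧ AlternatesAt (f '' C) (n j) (p j) := by
  have hnear : ∀ ε > 0, ∃ z, (z ∈ K ∩ W ∧ dist z x < ε) ∧
      0 < dist (f z) (f x) ∧ dist (f z) (f x) < ε := by
    intro ε hε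
    by_contra! hcon
    have hO : IsOpen (W ∩ Metric.ball x ε ∩ f ⁻¹' Metric.ball (f x) ε) :=
      (hW.inter Metric.isOpen_ball).inter (Metric.isOpen_ball.preimage hf)
    refine hK _ hO ⟨x, hx.1, ⟨hx.2, Metric.mem_ball_self hε⟩, Metric.mem_ball_self hε⟩ ?_
    refine ((closedOntoImage_fiber (f x)).piecewiseClosedCover
      (isClosed_singleton.preimage hf)).mono ?_
    rintro z ⟨hzK, ⟨hzW, hzx⟩, hzf⟩
    by_contra hne
    exact absurd hzf (not_lt.2 (hcon z ⟨⟨hzK, hzW⟩, hzx⟩ (dist_pos.2 hne)))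
  obtain ⟨u, e, V, he, he0, hu, hV, huV, hVe, hdisj⟩ :=
    exists_seq_disjoint_intervals (fun z => dist (f z) (f x))
      (fun z ε => z ∈ K ∩ W ∧ dist z x < ε) hnear
  have hO : ∀ j, IsOpen (W ∩ Metric.ball x (e j) ∩ (fun z => dist (f z) (f x)) ⁻¹' V j) :=
    fun j => (hW.inter Metric.isOpen_ball).inter ((hV j).preimage (by fun_prop))
  choose q hq C hC hCO hqC hqn using fun j =>
    hn j _ (hO j) ⟨u j, (hu j).1.1, ⟨(hu j).1.2, (hu j).2⟩, huV j⟩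
  have hS : ∀ j, ∀ s ∈ ({x} : Set X), dist (f s) (f x) ∉ V j := by
    rintro j s rfl hs
    exact absurd (hVe j hs).1 (by simp)
  have hloc := fun j => AlternatesAt.image_union_iUnion (f := f) (S := {x}) (y := f x) hV hdisj
    (fun j c hc => (hCO j hc).2.2) (hS j) (hq j).2.2
  refine ⟨{x} ∪ ⋃ j, C j, isClosed_union_iUnion isClosed_singleton hC ?_, ?_, Or.inl rfl,
    fun j => f (q j), ?_, fun j => ⟨fun h => hqC j ((hloc j).1.1 h), (hloc j).2 _ (hqn j)⟩⟩
  · intro z hz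
    have hzx : 0 < dist z x := dist_pos.2 hz
    refine ⟨Metric.ball z (dist z x / 2), Metric.ball_mem_nhds _ (half_pos hzx), ?_⟩
    filter_upwards [he.eventually_lt_const (half_pos hzx)] with j hj
    refine disjoint_left.2 fun w hw hwC => ?_
    have h₁ : dist w x < e j := (hCO j hwC).2.1.2
    have h₂ : dist w z < dist z x / 2 := hw
    linarith [dist_triangle_left z x w]
  · rintro w (rfl | hw)
    · exact hx
    · obtain ⟨j, hj⟩ := mem_iUnion.1 hw
      exact ⟨(hCO j hj).1, (hCO j hj).2.1.1⟩
  · refine hf.continuousAt.tendsto.comp (tendsto_iff_dist_tendsto_zero.2 ?_)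
    exact squeeze_zero (fun j => dist_nonneg) (fun j => le_of_lt (hq j).2.1.2) he

theorem AlternatesOutside.alternatesInside_succ (hf : Continuous f)
    (hK : ∀ W, IsOpen W → (K ∩ W).Nonempty → ¬ PiecewiseClosedCover f (K ∩ W))
    {n : ℕ} (hn : AlternatesOutside f K n) : AlternatesInside f K (n + 1) := by
  intro W hW x hx
  obtain ⟨C, hC, hCW, hxC, p, hp, hpn⟩ :=
    exists_isClosed_alternatesAt_seq hf hK (n := fun _ => n) (fun _ => hn) hW hx
  refine ⟨C, hC, hCW, hxC, hp.frequently (Frequently.of_forall fun j => ⟨?_, (hpn j).2⟩)⟩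
  simp [(hpn j).1, mem_image_of_mem f hxC]

theorem exists_isClosed_not_closedOntoImage (hKc : IsClosed K) {W : Set X} (hW : IsOpen W)
    (h : ¬ PiecewiseClosedCover f (K ∩ W)) :
    ∃ F, IsClosed F ∧ F ⊆ K ∩ W ∧ ¬ ClosedOntoImage f F := by
  obtain ⟨F, hF, -, hFW, -⟩ := hW.exists_iUnion_isClosed
  by_contra! hcon
  refine h ⟨fun n => K ∩ F n, fun n => hKc.inter (hF n), ?_, fun n => hcon _ (hKc.inter (hF n)) ?_⟩
  · rw [← inter_iUnion, hFW]
  · exact inter_subset_inter_right _ (hFW ▸ subset_iUnion F n)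

theorem AlternatesInside.alternatesOutside_succ (hf : Continuous f) (hKc : IsClosed K)
    (hK : ∀ W, IsOpen W → (K ∩ W).Nonempty → ¬ PiecewiseClosedCover f (K ∩ W))
    {n : ℕ} (hn : AlternatesInside f K n) : AlternatesOutside f K (n + 1) := by
  intro W hW hne
  obtain ⟨F, -, hFW, hF⟩ := exists_isClosed_not_closedOntoImage hKc hW (hK W hW hne)
  obtain ⟨E, hE, hEF, x, hxF, hxcl, hxE⟩ :
      ∃ E, IsClosed E ∧ E ⊆ F ∧ ∃ x ∈ F, f x ∈ closure (f '' E) ∧ f x ∉ f '' E := by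
    by_contra! hcon
    refine hF fun E hE hEF => ⟨closure (f '' E), isClosed_closure, Subset.antisymm
      (fun y hy => ⟨subset_closure hy, image_mono hEF hy⟩) ?_⟩
    rintro _ ⟨hy, x, hx, rfl⟩
    exact hcon E hE hEF x hx hy
  have hnear : ∀ ε > 0, ∃ z, z ∈ E ∧ 0 < dist (f z) (f x) ∧ dist (f z) (f x) < ε := by
    intro ε hε
    obtain ⟨_, ⟨z, hz, rfl⟩, hzd⟩ := Metric.mem_closure_iff.1 hxcl ε hε
    exact ⟨z, hz, dist_pos.2 fun h => hxE ⟨z, hz, h⟩, by rwa [dist_comm]⟩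
  obtain ⟨u, e, V, he, he0, hu, hV, huV, hVe, hdisj⟩ :=
    exists_seq_disjoint_intervals (fun z => dist (f z) (f x)) (fun z _ => z ∈ E) hnear
  have hO : ∀ j, IsOpen (W ∩ Metric.ball (u j) (e j) ∩ (fun z => dist (f z) (f x)) ⁻¹' V j) :=
    fun j => (hW.inter Metric.isOpen_ball).inter ((hV j).preimage (by fun_prop))
  have huW : ∀ j, u j ∈ K ∩ W := fun j => hFW (hEF (hu j))
  choose C hC hCO huC hCn using fun j => hn _ (hO j) (u j)
    ⟨(huW j).1, ⟨(huW j).2, Metric.mem_ball_self (he0 j)⟩, huV j⟩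
  have hloc := fun j => AlternatesAt.image_union_iUnion (f := f) (S := ∅) (y := f x) hV hdisj
    (fun j c hc => (hCO j hc).2.2) (fun s hs => absurd hs (notMem_empty s)) (huV j)
  have he2 : Tendsto (fun j => 2 * e j) atTop (𝓝 0) := by simpa using he.const_mul 2
  have hxC : f x ∉ f '' (∅ ∪ ⋃ j, C j) := by
    rintro ⟨c, hc | hc, hcx⟩
    · exact hc
    · obtain ⟨j, hj⟩ := mem_iUnion.1 hc
      have : 0 < dist (f c) (f x) := (hVe j (hCO j hj).2.2).1
      rw [hcx, dist_self] at this
      exact this.false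
  refine ⟨x, hFW hxF, ∅ ∪ ⋃ j, C j, isClosed_union_iUnion isClosed_empty hC ?_, ?_, hxC, ?_⟩
  · intro z _
    by_cases hzx : f z = f x
    · have hzE : z ∈ Eᶜ := fun h => hxE ⟨z, h, hzx⟩
      obtain ⟨ε, hε, hball⟩ := Metric.isOpen_iff.1 hE.isOpen_compl z hzE
      refine ⟨Metric.ball z (ε / 2), Metric.ball_mem_nhds _ (half_pos hε), ?_⟩
      filter_upwards [he.eventually_lt_const (half_pos hε)] with j hj
      refine disjoint_left.2 fun w hw hwC => hball (?_ : dist (u j) z < ε) (hu j)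
      have h₁ : dist w (u j) < e j := (hCO j hwC).2.1.2
      have h₂ : dist w z < ε / 2 := hw
      linarith [dist_triangle_left (u j) z w]
    · have hd : 0 < dist (f z) (f x) := dist_pos.2 hzx
      refine ⟨(fun w => dist (f w) (f x)) ⁻¹' Ioi (dist (f z) (f x) / 2),
        (isOpen_Ioi.preimage (by fun_prop)).mem_nhds (half_lt_self hd), ?_⟩
      filter_upwards [he2.eventually_lt_const (half_pos hd)] with j hj
      refine disjoint_left.2 fun w hw hwC => ?_
      have h₁ := (hVe j (hCO j hwC).2.2).2
      have h₂ : dist (f z) (f x) / 2 < dist (f w) (f x) := hw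
      linarith
  · rintro w (hw | hw)
    · exact absurd hw (notMem_empty w)
    · obtain ⟨j, hj⟩ := mem_iUnion.1 hw
      exact ⟨(hCO j hj).1, (hCO j hj).2.1.1⟩
  · have hlim : Tendsto (fun j => f (u j)) atTop (𝓝 (f x)) :=
      tendsto_iff_dist_tendsto_zero.2
        (squeeze_zero (fun j => dist_nonneg) (fun j => (hVe j (huV j)).2.le) he2)
    refine hlim.frequently (Frequently.of_forall fun j => ⟨?_, (hloc j).2 n (hCn j)⟩)
    exact iff_of_true ((hloc j).1.2 ⟨u j, huC j, rfl⟩) hxC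

theorem alternatesOutside (hf : Continuous f) (hKc : IsClosed K)
    (hK : ∀ W, IsOpen W → (K ∩ W).Nonempty → ¬ PiecewiseClosedCover f (K ∩ W)) (n : ℕ) :
    AlternatesOutside f K n := by
  suffices h : AlternatesOutside f K n ∧ AlternatesInside f K n from h.1
  induction n with
  | zero =>
    refine ⟨fun W _ ⟨x, hx⟩ => ⟨x, hx, ∅, isClosed_empty, empty_subset _, by simp, trivial⟩,
      fun W _ x hx => ⟨{x}, isClosed_singleton, singleton_subset_iff.2 hx, rfl, trivial⟩⟩
  | succ n ih =>
    exact ⟨ih.2.alternatesOutside_succ hf hKc hK, ih.1.alternatesInside_succ hf hK⟩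

theorem piecewiseClosedCover_univ [SecondCountableTopology X] (hf : Continuous f)
    (hcons : ∀ C : Set X, IsClosed C → Constructible (f '' C)) :
    PiecewiseClosedCover f (univ : Set X) := by
  by_contra h
  obtain ⟨K, hKc, ⟨x, hx⟩, hK⟩ := exists_isClosed_nowhere_piecewiseClosedCover h
  obtain ⟨C, hC, -, -, p, -, hp⟩ := exists_isClosed_alternatesAt_seq hf hK (n := id)
    (fun j => alternatesOutside hf hKc hK j) isOpen_univ ⟨hx, mem_univ x⟩
  obtain ⟨n, hn⟩ := (hcons C hC).exists_not_alternatesAt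
  exact hn (p n) (hp n).2

end Alternation

/-- Main theorem: every continuous closed-constructible surjection between separable
metrizable spaces is piece-wise closed: `X` is a countable union of closed sets `Z n`
such that the restriction of `f` to each `Z n` is a closed map onto its image
(i.e. closed subsets of the subspace `Z n` are mapped to closed subsets of the
subspace `f '' Z n`). -/
theorem closedConstructible_is_piecewise_closed
    {X Y : Type*} [TopologicalSpace X] [TopologicalSpace Y]
    [MetrizableSpace X] [SeparableSpace X]
    [MetrizableSpace Y] [SeparableSpace Y]
    (f : X → Y) (hcont : Continuous f) (hsurj : Function.Surjective f)
    (hcons : ∀ C : Set X, IsClosed C → Constructible (f '' C)) :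
    ∃ Z : ℕ → Set X, (∀ n, IsClosed (Z n)) ∧ (⋃ n, Z n) = Set.univ ∧
      ∀ n, ∀ C : Set X, IsClosed C → C ⊆ Z n →
        ∃ D : Set Y, IsClosed D ∧ f '' C = D ∩ f '' Z n := by
  let := metrizableSpaceMetric X
  let := metrizableSpaceMetric Y
  have := UniformSpace.secondCountable_of_separable X
  obtain ⟨Z, hZ, hcover, hZf⟩ := piecewiseClosedCover_univ hcont hcons
  exact ⟨Z, hZ, univ_subset_iff.1 hcover, hZf⟩
end

section
/- Let X and Y be separable metrizable topological spaces and let f : X → Y be a one-to-one surjection that is an open map (images of open sets are open) and constructible-measurable (the preimage f⁻¹(U) of every open set U ⊆ Y is a constructible subset of X). Then f is piece-wise continuous, i.e. X can be written as a countable union of closed sets Zₙ such that the restriction of f to each Zₙ is continuous. -/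
open TopologicalSpace

open Set

section PiecewiseCoverable

variable {X Y : Type*} [TopologicalSpace X] [TopologicalSpace Y]

theorem Constructible.isGδ_and_isGδ_compl [MetrizableSpace X] {A : Set X}
    (hA : Constructible A) : IsGδ A ∧ IsGδ Aᶜ := by
  let := metrizableSpaceMetric X
  induction hA with
  | of_isOpen hU => exact ⟨hU.isGδ, hU.isClosed_compl.isGδ⟩
  | inter _ _ hA hB =>
    refine ⟨hA.1.inter hB.1, ?_⟩
    rw [compl_inter]
    exact hA.2.union hB.2
  | compl _ hA => exact ⟨hA.2, by simpa using hA.1⟩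

/-- A constructible set cannot be both dense and codense in a nonempty set. -/
theorem Constructible.exists_isOpen_inter_subset {A : Set X} (hA : Constructible A) :
    ∀ E : Set X, E.Nonempty →
      ∃ V, IsOpen V ∧ (V ∩ E).Nonempty ∧ (V ∩ E ⊆ A ∨ V ∩ E ⊆ Aᶜ) := by
  induction hA with
  | @of_isOpen U hU =>
    intro E hE
    by_cases h : (U ∩ E).Nonempty
    · exact ⟨U, hU, h, Or.inl inter_subset_left⟩
    · refine ⟨univ, isOpen_univ, by simpa using hE, Or.inr ?_⟩
      rintro x ⟨-, hx⟩ hxU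
      exact h ⟨x, hxU, hx⟩
  | @inter A B _ _ hA hB =>
    intro E hE
    obtain ⟨V, hV, hVE, hVA⟩ := hA E hE
    rcases hVA with hVA | hVA
    · obtain ⟨V', hV', hVE', hVB⟩ := hB (V ∩ E) hVE
      refine ⟨V' ∩ V, hV'.inter hV, by rwa [inter_assoc], ?_⟩
      rw [inter_assoc]
      rcases hVB with hVB | hVB
      · exact Or.inl (subset_inter (inter_subset_right.trans hVA) hVB)
      · exact Or.inr fun x hx hx' => hVB hx hx'.2
    · exact ⟨V, hV, hVE, Or.inr fun x hx hx' => hVA hx hx'.1⟩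
  | compl _ hA =>
    intro E hE
    obtain ⟨V, hV, hVE, h⟩ := hA E hE
    exact ⟨V, hV, hVE, by rw [compl_compl]; exact h.symm⟩

/-- `A` is covered by countably many closed sets on each of which `f` is continuous. -/
def PiecewiseCoverable (f : X → Y) (A : Set X) : Prop :=
  ∃ S : Set (Set X), S.Countable ∧ (∀ Z ∈ S, IsClosed Z ∧ ContinuousOn f Z) ∧ A ⊆ ⋃₀ S

namespace PiecewiseCoverable

variable {f : X → Y} {A B : Set X}

theorem mono (hB : PiecewiseCoverable f B) (h : A ⊆ B) : PiecewiseCoverable f A := by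
  obtain ⟨S, hS, hS', hB⟩ := hB
  exact ⟨S, hS, hS', h.trans hB⟩

theorem of_isClosed (hA : IsClosed A) (h : ContinuousOn f A) : PiecewiseCoverable f A :=
  ⟨{A}, countable_singleton A, by simpa using ⟨hA, h⟩, by simp⟩

theorem sUnion {T : Set (Set X)} (hT : T.Countable) (h : ∀ A ∈ T, PiecewiseCoverable f A) :
    PiecewiseCoverable f (⋃₀ T) := by
  choose! S hS hS' hA using h
  refine ⟨⋃ A ∈ T, S A, hT.biUnion hS, ?_, ?_⟩
  · intro Z hZ
    simp only [mem_iUnion] at hZ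
    obtain ⟨A, hAT, hZ⟩ := hZ
    exact hS' A hAT Z hZ
  · rintro x ⟨A, hAT, hx⟩
    obtain ⟨Z, hZ, hxZ⟩ := hA A hAT hx
    exact ⟨Z, mem_biUnion hAT hZ, hxZ⟩

theorem union (hA : PiecewiseCoverable f A) (hB : PiecewiseCoverable f B) :
    PiecewiseCoverable f (A ∪ B) := by
  rw [← sUnion_pair]
  refine sUnion (by simp) ?_
  rintro C (rfl | rfl)
  exacts [hA, hB]

theorem of_subsingleton [T1Space X] (hA : A.Subsingleton) : PiecewiseCoverable f A :=
  of_isClosed hA.isClosed (hA.continuousOn f)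

theorem exists_nat_cover (h : PiecewiseCoverable f univ) :
    ∃ Z : ℕ → Set X, (∀ n, IsClosed (Z n)) ∧ (⋃ n, Z n) = univ ∧
      ∀ n, ContinuousOn f (Z n) := by
  obtain ⟨S, hS, hS', hcov⟩ := h
  obtain ⟨Z, hZ⟩ := (hS.insert ∅).exists_eq_range (insert_nonempty _ _)
  have hmem : ∀ n, IsClosed (Z n) ∧ ContinuousOn f (Z n) := by
    intro n
    have hn : Z n ∈ insert ∅ S := hZ ▸ mem_range_self n
    rcases hn with hn | hn
    · simp [hn]
    · exact hS' _ hn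
  refine ⟨Z, fun n => (hmem n).1, ?_, fun n => (hmem n).2⟩
  rw [← sUnion_range, ← hZ]
  exact univ_subset_iff.1 (hcov.trans (sUnion_subset_sUnion (subset_insert _ _)))

/-- The largest relatively open coverable part of a set is coverable. -/
theorem inter_sUnion_isOpen [SecondCountableTopology X] (f : X → Y) (A : Set X) :
    PiecewiseCoverable f (A ∩ ⋃₀ {V | IsOpen V ∧ PiecewiseCoverable f (A ∩ V)}) := by
  obtain ⟨T, hT, hTS, hU⟩ := TopologicalSpace.isOpen_sUnion_countable
    {V | IsOpen V ∧ PiecewiseCoverable f (A ∩ V)} fun V hV => hV.1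
  rw [← hU]
  refine (sUnion (hT.image (A ∩ ·)) ?_).mono ?_
  · rintro _ ⟨V, hV, rfl⟩
    exact (hTS hV).2
  · rintro x ⟨hxA, V, hV, hx⟩
    exact ⟨_, ⟨V, hV, rfl⟩, hxA, hx⟩

theorem inter_preimage_sUnion_isOpen [SecondCountableTopology Y] (f : X → Y) (A : Set X) :
    PiecewiseCoverable f
      (A ∩ f ⁻¹' ⋃₀ {O | IsOpen O ∧ PiecewiseCoverable f (A ∩ f ⁻¹' O)}) := by
  obtain ⟨T, hT, hTS, hU⟩ := TopologicalSpace.isOpen_sUnion_countable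
    {O | IsOpen O ∧ PiecewiseCoverable f (A ∩ f ⁻¹' O)} fun V hV => hV.1
  rw [← hU]
  refine (sUnion (hT.image (A ∩ f ⁻¹' ·)) ?_).mono ?_
  · rintro _ ⟨V, hV, rfl⟩
    exact (hTS hV).2
  · rintro x ⟨hxA, V, hV, hx⟩
    exact ⟨_, ⟨V, hV, rfl⟩, hxA, hx⟩

end PiecewiseCoverable

variable {f : X → Y}

theorem exists_irreducible_of_isClosed [SecondCountableTopology X] [T3Space Y]
    {A : Set X} (hA : IsClosed A) (hbad : ¬ PiecewiseCoverable f A) :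
    ∃ x ∈ A, ∃ U, IsOpen U ∧ f x ∈ U ∧
      ∀ V, IsOpen V → x ∈ V → ¬ PiecewiseCoverable f ((A ∩ V) \ f ⁻¹' closure U) := by
  by_contra! hcon
  set R := ⋃₀ {V | IsOpen V ∧ PiecewiseCoverable f (A ∩ V)} with hR
  have hRo : IsOpen R := isOpen_sUnion fun V hV => hV.1
  have hcont : ContinuousOn f (A \ R) := by
    intro x hx
    refine ((closed_nhds_basis (f x)).tendsto_right_iff).2 fun K hK => ?_
    obtain ⟨U, hUK, hU, hxU⟩ := mem_nhds_iff.1 hK.1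
    obtain ⟨V, hV, hxV, hVg⟩ := hcon x hx.1 U hU hxU
    filter_upwards [inter_mem_nhdsWithin _ (hV.mem_nhds hxV)] with y hy
    by_contra hyK
    have hyU : f y ∈ (closure U)ᶜ := fun h => hyK (closure_minimal hUK hK.2 h)
    obtain ⟨L, ⟨hL, hLc⟩, hLU⟩ := (closed_nhds_basis (f y)).mem_iff.1
      (isClosed_closure.isOpen_compl.mem_nhds hyU)
    obtain ⟨U', hUL', hU', hyU'⟩ := mem_nhds_iff.1 hL
    obtain ⟨V', hV', hyV', hVg'⟩ := hcon y hy.1.1 U' hU' hyU'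
    refine hy.1.2 ⟨V ∩ V', ⟨hV.inter hV', (hVg.union hVg').mono ?_⟩, hy.2, hyV'⟩
    rintro z ⟨hzA, hzV, hzV'⟩
    by_cases hz : f z ∈ closure U
    · exact Or.inr ⟨⟨hzA, hzV'⟩, fun h => hLU (closure_minimal hUL' hLc h) hz⟩
    · exact Or.inl ⟨⟨hzA, hzV⟩, hz⟩
  refine hbad (((PiecewiseCoverable.of_isClosed (hA.sdiff hRo) hcont).union
    (PiecewiseCoverable.inter_sUnion_isOpen f A)).mono ?_)
  rw [← hR, sdiff_union_inter]

theorem exists_irreducible_of_isGδ_compl [SecondCountableTopology X] [T3Space Y]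
    {A : Set X} (hA : IsGδ Aᶜ) (hbad : ¬ PiecewiseCoverable f A) :
    ∃ x ∈ A, ∃ U, IsOpen U ∧ f x ∈ U ∧
      ∀ V, IsOpen V → x ∈ V → ¬ PiecewiseCoverable f ((A ∩ V) \ f ⁻¹' closure U) := by
  obtain ⟨T, hTo, hT, hTA⟩ := hA
  have hAT : A = ⋃₀ (compl '' T) := by rw [← compl_sInter, ← hTA, compl_compl]
  obtain ⟨F, hF, hFbad⟩ : ∃ F ∈ T, ¬ PiecewiseCoverable f Fᶜ := by
    by_contra! h
    refine hbad (hAT ▸ PiecewiseCoverable.sUnion (hT.image _) ?_)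
    rintro _ ⟨F, hF, rfl⟩
    exact h F hF
  have hFA : Fᶜ ⊆ A := by
    rw [hAT]
    exact subset_sUnion_of_mem (mem_image_of_mem _ hF)
  obtain ⟨x, hx, U, hU, hxU, h⟩ :=
    exists_irreducible_of_isClosed (hTo F hF).isClosed_compl hFbad
  exact ⟨x, hFA hx, U, hU, hxU, fun V hV hxV hg => h V hV hxV (hg.mono (by gcongr))⟩

/-- A set that is not coverable has two non-coverable pieces with separated images. -/
theorem exists_split_of_not_piecewiseCoverable [T1Space X] [SecondCountableTopology Y]
    [T3Space Y] (hinj : Function.Injective f) {A : Set X} (hbad : ¬ PiecewiseCoverable f A) :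
    ∃ O₁ O₂ : Set Y, IsOpen O₁ ∧ IsOpen O₂ ∧ Disjoint (closure O₁) (closure O₂) ∧
      ¬ PiecewiseCoverable f (A ∩ f ⁻¹' O₁) ∧ ¬ PiecewiseCoverable f (A ∩ f ⁻¹' O₂) := by
  set R := ⋃₀ {O | IsOpen O ∧ PiecewiseCoverable f (A ∩ f ⁻¹' O)} with hR
  have hns : ¬ (Rᶜ).Subsingleton := by
    intro hs
    refine hbad (((PiecewiseCoverable.of_subsingleton (hs.preimage hinj)).union
      (PiecewiseCoverable.inter_preimage_sUnion_isOpen f A)).mono ?_)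
    intro x hx
    by_cases h : f x ∈ R
    · exact Or.inr ⟨hx, h⟩
    · exact Or.inl h
  obtain ⟨y₁, hy₁, y₂, hy₂, hne⟩ := not_subsingleton_iff.1 hns
  obtain ⟨O₁, hyO₁, hO₁, O₂, hyO₂, hO₂, hd⟩ := exists_open_nhds_disjoint_closure hne
  exact ⟨O₁, O₂, hO₁, hO₂, hd, fun h => hy₁ ⟨O₁, ⟨hO₁, h⟩, hyO₁⟩,
    fun h => hy₂ ⟨O₂, ⟨hO₂, h⟩, hyO₂⟩⟩

/-- Every neighbourhood of `x` has a non-coverable part mapped by `f` outside `C`. -/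
def IrreducibleOutside (f : X → Y) (x : X) (C : Set Y) : Prop :=
  ∀ V, IsOpen V → x ∈ V → ¬ PiecewiseCoverable f (V \ f ⁻¹' C)

theorem IrreducibleOutside.anti {x : X} {C D : Set Y} (h : IrreducibleOutside f x D)
    (hCD : C ⊆ D) : IrreducibleOutside f x C :=
  fun V hV hx hg => h V hV hx (hg.mono (by gcongr))

theorem exists_isOpen_irreducibleOutside [T1Space X] [SecondCountableTopology Y]
    [T3Space Y] (hinj : Function.Injective f) {A : Set X} (hbad : ¬ PiecewiseCoverable f A)
    {C : Set Y} {P : Set X} (hP : P.Finite) (hirr : ∀ p ∈ P, IrreducibleOutside f p C) :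
    ∃ O, IsOpen O ∧ ¬ PiecewiseCoverable f (A ∩ f ⁻¹' O) ∧
      ∀ p ∈ P, IrreducibleOutside f p (C ∪ closure O) := by
  induction P, hP using Set.Finite.induction_on with
  | empty => exact ⟨univ, isOpen_univ, by simpa using hbad, by simp⟩
  | @insert p P _ _ ih =>
    obtain ⟨O, hO, hObad, hOirr⟩ := ih fun q hq => hirr q (mem_insert_of_mem _ hq)
    obtain ⟨O₁, O₂, hO₁, hO₂, hd, h₁, h₂⟩ :=
      exists_split_of_not_piecewiseCoverable hinj hObad
    have key : IrreducibleOutside f p (C ∪ closure (O ∩ O₁)) ∨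
        IrreducibleOutside f p (C ∪ closure (O ∩ O₂)) := by
      by_contra! h
      obtain ⟨h₁, h₂⟩ := h
      simp only [IrreducibleOutside, not_forall, not_not] at h₁ h₂
      obtain ⟨V₁, hV₁, hp₁, hg₁⟩ := h₁
      obtain ⟨V₂, hV₂, hp₂, hg₂⟩ := h₂
      refine hirr p (mem_insert _ _) (V₁ ∩ V₂) (hV₁.inter hV₂) ⟨hp₁, hp₂⟩
        ((hg₁.union hg₂).mono ?_)
      rintro z ⟨⟨hz₁, hz₂⟩, hzC⟩
      by_cases hz : f z ∈ closure O₁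
      · refine Or.inr ⟨hz₂, ?_⟩
        rintro (h | h)
        · exact hzC h
        · exact disjoint_left.1 hd hz (closure_mono inter_subset_right h)
      · refine Or.inl ⟨hz₁, ?_⟩
        rintro (h | h)
        · exact hzC h
        · exact hz (closure_mono inter_subset_right h)
    have extend : ∀ Q, IsOpen Q → ¬ PiecewiseCoverable f (A ∩ f ⁻¹' O ∩ f ⁻¹' Q) →
        IrreducibleOutside f p (C ∪ closure (O ∩ Q)) →
        ∃ O, IsOpen O ∧ ¬ PiecewiseCoverable f (A ∩ f ⁻¹' O) ∧
          ∀ q ∈ insert p P, IrreducibleOutside f q (C ∪ closure O) := by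
      intro Q hQ hQbad hpQ
      refine ⟨O ∩ Q, hO.inter hQ, by rwa [preimage_inter, ← inter_assoc], ?_⟩
      rintro q (rfl | hq)
      · exact hpQ
      · exact (hOirr q hq).anti (by gcongr; exact inter_subset_left)
    rcases key with h | h
    exacts [extend O₁ hO₁ h₁ h, extend O₂ hO₂ h₂ h]

/-- Finite approximations to a set on which the preimage of an open set is dense and
codense. -/
structure SplitApprox (f : X → Y) where
  points : Set X
  finite : points.Finite
  inside : Set Y
  outside : Set Y
  isOpen_inside : IsOpen inside
  disjoint : Disjoint inside outside
  irreducible : ∀ p ∈ points, IrreducibleOutside f p (closure inside ∪ closure outside)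

namespace SplitApprox

instance : Preorder (SplitApprox f) where
  le s t := s.points ⊆ t.points ∧ s.inside ⊆ t.inside ∧ s.outside ⊆ t.outside
  le_refl s := ⟨Subset.rfl, Subset.rfl, Subset.rfl⟩
  le_trans _ _ _ h h' := ⟨h.1.trans h'.1, h.2.1.trans h'.2.1, h.2.2.trans h'.2.2⟩

theorem exists_new_point [SecondCountableTopology X] [MetrizableSpace X]
    [SecondCountableTopology Y] [T3Space Y] (hinj : Function.Injective f)
    (hmeas : ∀ U : Set Y, IsOpen U → Constructible (f ⁻¹' U))
    {P : Set X} (hP : P.Finite) {C : Set Y} (hC : IsClosed C)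
    (hirr : ∀ p ∈ P, IrreducibleOutside f p C) {p : X} (hp : p ∈ P)
    {V : Set X} (hV : IsOpen V) (hpV : p ∈ V) :
    ∃ x ∈ V, ∃ U, IsOpen U ∧ f x ∈ U ∧ Disjoint U C ∧
      ∀ q ∈ insert x P, IrreducibleOutside f q (C ∪ closure U) := by
  obtain ⟨O, hO, hObad, hOirr⟩ :=
    exists_isOpen_irreducibleOutside hinj (hirr p hp V hV hpV) hP hirr
  have hset : V \ f ⁻¹' C ∩ f ⁻¹' O = V ∩ f ⁻¹' (O \ C) := by
    ext z
    simp only [mem_inter_iff, mem_sdiff, mem_preimage]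
    tauto
  rw [hset] at hObad
  obtain ⟨x, ⟨hxV, hxO, hxC⟩, U, hU, hxU, hx⟩ := exists_irreducible_of_isGδ_compl
    ((Constructible.of_isOpen hV).inter (hmeas _ (hO.sdiff hC))).isGδ_and_isGδ_compl.2 hObad
  refine ⟨x, hxV, U ∩ (O \ C), hU.inter (hO.sdiff hC), ⟨hxU, hxO, hxC⟩,
    disjoint_left.2 fun z hz hz' => hz.2.2 hz', ?_⟩
  rintro q (rfl | hq)
  · intro V' hV' hqV' hg
    refine hx V' hV' hqV' (hg.mono ?_)
    rintro z ⟨⟨⟨-, -, hzC⟩, hzV'⟩, hzU⟩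
    refine ⟨hzV', ?_⟩
    rintro (h | h)
    · exact hzC h
    · exact hzU (closure_mono inter_subset_left h)
  · refine (hOirr q hq).anti ?_
    gcongr
    exact inter_subset_right.trans sdiff_subset

theorem exists_extension [SecondCountableTopology X] [MetrizableSpace X]
    [SecondCountableTopology Y] [T3Space Y] (hinj : Function.Injective f)
    (hmeas : ∀ U : Set Y, IsOpen U → Constructible (f ⁻¹' U))
    (s : SplitApprox f) {V : Set X} (hV : IsOpen V) (hsV : (s.points ∩ V).Nonempty) :
    ∃ t, s ≤ t ∧ (∃ x ∈ t.points ∩ V, f x ∈ t.inside) ∧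
      ∃ x ∈ t.points ∩ V, f x ∈ t.outside := by
  obtain ⟨p, hp, hpV⟩ := hsV
  obtain ⟨x, hxV, U, hU, hxU, hUC, hirr⟩ := exists_new_point hinj hmeas s.finite
    (isClosed_closure.union isClosed_closure) s.irreducible hp hV hpV
  obtain ⟨x', hxV', U', hU', hxU', hUC', hirr'⟩ := exists_new_point hinj hmeas
    (s.finite.insert x) ((isClosed_closure.union isClosed_closure).union isClosed_closure)
    hirr (mem_insert_of_mem x hp) hV hpV
  refine ⟨⟨insert x' (insert x s.points), (s.finite.insert x).insert x', s.inside ∪ U,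
    s.outside ∪ U', s.isOpen_inside.union hU, ?_, ?_⟩, ⟨?_, ?_, ?_⟩, ⟨x, ?_, ?_⟩,
    ⟨x', ?_, ?_⟩⟩
  · rw [disjoint_union_left, disjoint_union_right, disjoint_union_right]
    refine ⟨⟨s.disjoint, ?_⟩, ?_, ?_⟩
    · exact (hUC'.mono_right fun z hz => Or.inl (Or.inl (subset_closure hz))).symm
    · exact hUC.mono_right fun z hz => Or.inr (subset_closure hz)
    · exact (hUC'.mono_right fun z hz => Or.inr (subset_closure hz)).symm
  · intro q hq
    refine (hirr' q hq).anti ?_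
    rw [closure_union, closure_union]
    intro z hz
    simp only [mem_union] at hz ⊢
    tauto
  · exact (subset_insert _ _).trans (subset_insert _ _)
  · exact subset_union_left
  · exact subset_union_left
  · exact ⟨by simp, hxV⟩
  · exact Or.inr hxU
  · exact ⟨by simp, hxV'⟩
  · exact Or.inr hxU'

/-- The approximations that decide whether the limiting set meets `V`, and in that case meet
`V` on both sides. -/
def deciding (f : X → Y) (V : Set X) : Set (SplitApprox f) :=
  {s | ((∃ x ∈ s.points ∩ V, f x ∈ s.inside) ∧ ∃ x ∈ s.points ∩ V, f x ∈ s.outside) ∨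
    ∀ t, s ≤ t → ¬ (t.points ∩ V).Nonempty}

theorem isCofinal_deciding [SecondCountableTopology X] [MetrizableSpace X]
    [SecondCountableTopology Y] [T3Space Y] (hinj : Function.Injective f)
    (hmeas : ∀ U : Set Y, IsOpen U → Constructible (f ⁻¹' U)) {V : Set X} (hV : IsOpen V) :
    IsCofinal (deciding f V) := by
  intro s
  by_cases h : ∃ t, s ≤ t ∧ (t.points ∩ V).Nonempty
  · obtain ⟨t, hst, ht⟩ := h
    obtain ⟨u, htu, hu⟩ := exists_extension hinj hmeas t hV ht
    exact ⟨u, Or.inl hu, hst.trans htu⟩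
  · push Not at h
    exact ⟨s, Or.inr fun t hst => by simp [h t hst], le_rfl⟩

end SplitApprox

theorem piecewiseCoverable_univ_of_injective [SecondCountableTopology X] [MetrizableSpace X]
    [SecondCountableTopology Y] [T3Space Y] (hinj : Function.Injective f)
    (hmeas : ∀ U : Set Y, IsOpen U → Constructible (f ⁻¹' U)) :
    PiecewiseCoverable f univ := by
  by_contra hbad
  obtain ⟨x₀, -, U₀, -, -, hx₀⟩ := exists_irreducible_of_isClosed isClosed_univ hbad
  let s₀ : SplitApprox f :=
    { points := {x₀}
      finite := finite_singleton x₀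
      inside := ∅
      outside := ∅
      isOpen_inside := isOpen_empty
      disjoint := disjoint_empty _
      irreducible := by
        rintro _ rfl V hV hxV hg
        refine hx₀ V hV hxV (hg.mono ?_)
        rintro z ⟨⟨-, hz⟩, -⟩
        exact ⟨hz, by simp⟩ }
  have : Encodable (countableBasis X) := Encodable.ofCountable _
  let D : countableBasis X → Order.Cofinal (SplitApprox f) := fun V =>
    ⟨SplitApprox.deciding f V,
      SplitApprox.isCofinal_deciding hinj hmeas (isOpen_of_mem_countableBasis V.2)⟩
  let I := Order.idealOfCofinals s₀ D
  have hs₀ : s₀ ∈ I := Order.mem_idealOfCofinals s₀ D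
  let E : Set X := ⋃ s ∈ I, s.points
  let W : Set Y := ⋃ s ∈ I, s.inside
  have hW : IsOpen W := isOpen_biUnion fun s _ => s.isOpen_inside
  have hout : ∀ s ∈ I, Disjoint W s.outside := by
    intro s hs
    refine disjoint_left.2 fun y hy hys => ?_
    simp only [W, mem_iUnion] at hy
    obtain ⟨t, ht, hyt⟩ := hy
    obtain ⟨u, hu, hsu, htu⟩ := I.directed s hs t ht
    exact disjoint_left.1 u.disjoint (htu.2.1 hyt) (hsu.2.2 hys)
  obtain ⟨V, hV, ⟨p, hpV, hpE⟩, hVE⟩ := (hmeas W hW).exists_isOpen_inter_subset E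
    ⟨x₀, mem_biUnion hs₀ rfl⟩
  obtain ⟨B, hB, hpB, hBV⟩ := (isBasis_countableBasis X).exists_subset_of_mem_open hpV hV
  obtain ⟨s, hsD, hsI⟩ := Order.cofinal_meets_idealOfCofinals s₀ D ⟨B, hB⟩
  have hs : (∃ x ∈ s.points ∩ B, f x ∈ s.inside) ∧ ∃ x ∈ s.points ∩ B, f x ∈ s.outside := by
    refine Or.resolve_right hsD fun h => ?_
    simp only [E, mem_iUnion] at hpE
    obtain ⟨t, ht, hpt⟩ := hpE
    obtain ⟨u, hu, hsu, htu⟩ := I.directed s hsI t ht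
    exact h u hsu ⟨p, htu.1 hpt, hpB⟩
  obtain ⟨⟨x, hx, hxs⟩, x', hx', hxs'⟩ := hs
  rcases hVE with hVE | hVE
  · exact disjoint_left.1 (hout s hsI) (hVE ⟨hBV hx'.2, mem_biUnion hsI hx'.1⟩) hxs'
  · exact hVE ⟨hBV hx.2, mem_biUnion hsI hx.1⟩ (mem_biUnion hsI hxs)

end PiecewiseCoverable

/-- Every one-to-one, open, constructible-measurable surjection between separable
metrizable spaces is piece-wise continuous. -/
theorem open_constructibleMeasurable_bijection_is_piecewise_continuous
    {X Y : Type*} [TopologicalSpace X] [TopologicalSpace Y]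
    [MetrizableSpace X] [SeparableSpace X]
    [MetrizableSpace Y] [SeparableSpace Y]
    (f : X → Y) (hinj : Function.Injective f) (hsurj : Function.Surjective f)
    (hopen : IsOpenMap f)
    (hmeas : ∀ U : Set Y, IsOpen U → Constructible (f ⁻¹' U)) :
    ∃ Z : ℕ → Set X, (∀ n, IsClosed (Z n)) ∧ (⋃ n, Z n) = Set.univ ∧
      ∀ n, ContinuousOn f (Z n) := by
  let := metrizableSpaceMetric X
  let := metrizableSpaceMetric Y
  have := UniformSpace.secondCountable_of_separable X
  have := UniformSpace.secondCountable_of_separable Y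
  exact (piecewiseCoverable_univ_of_injective hinj hmeas).exists_nat_cover
end

section
/- Let X and Y be separable metrizable topological spaces and let f : X → Y be a one-to-one surjection that is a closed map (images of closed sets are closed) and constructible-measurable (the preimage f⁻¹(U) of every open set U ⊆ Y is a constructible subset of X). Then f is piece-wise continuous, i.e. X can be written as a countable union of closed sets Zₙ such that the restriction of f to each Zₙ is continuous. -/
open TopologicalSpace

open Set Topology

namespace Constructible

variable {X Y : Type*} [TopologicalSpace X] [TopologicalSpace Y]

theorem preimage {A : Set Y} (hA : Constructible A) {g : X → Y} (hg : Continuous g) :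
    Constructible (g ⁻¹' A) := by
  induction hA with
  | of_isOpen hU => exact .of_isOpen (hU.preimage hg)
  | inter _ _ ihA ihB => exact ihA.inter ihB
  | compl _ ih => exact ih.compl

theorem interior_frontier_eq_empty {A : Set X} (hA : Constructible A) :
    interior (frontier A) = ∅ := by
  induction hA with
  | of_isOpen hU => rw [← frontier_compl, interior_frontier hU.isClosed_compl]
  | @inter A B _ _ ihA ihB =>
    have hsub : frontier (A ∩ B) ⊆ frontier A ∪ frontier B :=
      (frontier_inter_subset A B).trans
        (union_subset_union inter_subset_left inter_subset_right)
    refine subset_empty_iff.mp ((interior_mono hsub).trans ?_)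
    rw [interior_union_isClosed_of_interior_empty isClosed_frontier ihB, ihA]
  | compl _ ih => rwa [frontier_compl]

/-- A constructible set cannot be both dense and codense in a nonempty subspace. -/
theorem not_subset_closure_inter_and_diff {A T : Set X} (hA : Constructible A)
    (hT : T.Nonempty) (hTA : T ⊆ closure (T ∩ A)) (hTA' : T ⊆ closure (T \ A)) : False := by
  have hfr : frontier ((↑) ⁻¹' A : Set T) = univ := by
    refine eq_univ_of_forall fun x => ?_
    rw [frontier_eq_closure_inter_closure]
    constructor
    · rw [closure_subtype, Subtype.image_preimage_coe]
      exact hTA x.2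
    · rw [closure_subtype, ← preimage_compl, Subtype.image_preimage_coe]
      exact hTA' x.2
  have hempty := (hA.preimage (continuous_subtype_val (p := (· ∈ T)))).interior_frontier_eq_empty
  rw [hfr, interior_univ] at hempty
  exact (hempty ▸ mem_univ (⟨_, hT.some_mem⟩ : T) : _ ∈ (∅ : Set T))

end Constructible

/-- Boundary points of an open set can be approximated by a relatively discrete subset of any
given dense set. -/
theorem exists_pairwiseDisjoint_isOpen_subset_closure {X : Type*} [PseudoMetricSpace X]
    {U D Q : Set X} (hU : IsOpen U) (hD : Dense D) (hQ : Q ⊆ closure U \ U) (hne : Q.Nonempty) :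
    ∃ (P : Set X) (V : X → Set X), P ⊆ D ∧ (∀ p ∈ P, IsOpen (V p) ∧ p ∈ V p ∧ V p ⊆ U) ∧
      P.PairwiseDisjoint V ∧ Q ⊆ closure P := by
  set ρ : X → ℝ := fun x => Metric.infDist x Uᶜ
  have hUc : (Uᶜ).Nonempty := hne.mono fun q hq => (hQ hq).2
  have hρpos : ∀ x ∈ U, 0 < ρ x := fun x hx =>
    (hU.isClosed_compl.notMem_iff_infDist_pos hUc).mp (by simpa using hx)
  have hlip : ∀ x y, ρ x ≤ ρ y + dist x y := fun x y => Metric.infDist_le_infDist_add_dist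
  obtain ⟨P, hP⟩ := zorn_subset
    {P : Set X | P ⊆ D ∩ U ∧ P.Pairwise fun x y => min (ρ x) (ρ y) ≤ dist x y} (by
      intro c hc hchain
      refine ⟨⋃₀ c, ⟨sUnion_subset fun s hs => (hc hs).1, ?_⟩, fun s hs => subset_sUnion_of_mem hs⟩
      exact (pairwise_sUnion hchain.directedOn).mpr fun s hs => (hc hs).2)
  obtain ⟨⟨hPsub, hPsep⟩, hmax⟩ := hP
  refine ⟨P, fun p => Metric.ball p (ρ p / 4), fun p hp => (hPsub hp).1, fun p hp => ?_, ?_, ?_⟩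
  · have hpos := hρpos p (hPsub hp).2
    refine ⟨Metric.isOpen_ball, Metric.mem_ball_self (by positivity), fun y hy => ?_⟩
    by_contra hyU
    have h1 : ρ p ≤ dist p y := Metric.infDist_le_dist_of_mem hyU
    rw [Metric.mem_ball, dist_comm] at hy
    linarith
  · intro p hp q hq hpq
    refine Metric.ball_disjoint_ball ?_
    have h1 := hPsep hp hq hpq
    have h2 := hlip p q
    have h3 := hlip q p
    rw [dist_comm q p] at h3
    have h4 := hρpos p (hPsub hp).2
    have h5 := hρpos q (hPsub hq).2
    rcases min_le_iff.mp h1 with h | h <;> linarith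
  · intro q hq
    rw [Metric.mem_closure_iff]
    intro ε hε
    obtain ⟨z, ⟨hzball, hzU⟩, hzD⟩ := hD.inter_open_nonempty (Metric.ball q (ε / 2) ∩ U)
      (Metric.isOpen_ball.inter hU)
      (mem_closure_iff.mp (hQ hq).1 _ Metric.isOpen_ball (Metric.mem_ball_self (by positivity)))
    have hzq : dist z q < ε / 2 := hzball
    by_cases hzP : z ∈ P
    · exact ⟨z, hzP, by rw [dist_comm]; linarith⟩
    have hρz : ρ z ≤ dist z q := Metric.infDist_le_dist_of_mem (hQ hq).2
    by_contra! hfar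
    refine hzP (hmax ⟨insert_subset ⟨hzD, hzU⟩ hPsub, ?_⟩ (subset_insert z P) (mem_insert z P))
    have : Std.Symm fun x y : X => min (ρ x) (ρ y) ≤ dist x y :=
      ⟨fun x y h => by rwa [min_comm, dist_comm]⟩
    refine (pairwise_insert_of_symm_of_notMem hzP).mpr ⟨hPsep, fun y hy => ?_⟩
    refine (min_le_left _ _).trans ?_
    have h1 := hfar y hy
    have h2 := dist_triangle_left q y z
    linarith

section Oscillation

variable {X Y : Type*} [TopologicalSpace X] [TopologicalSpace Y]

/-- If `closure (f ⁻¹' O)` is a neighbourhood of `x` for every `x` in an open set `G` and every open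
`O` containing `f x`, then `f` is continuous on `G`. -/
theorem continuousOn_of_mem_interior_closure_preimage [RegularSpace Y] {f : X → Y} {G : Set X}
    (hG : IsOpen G) (hmeas : ∀ U : Set Y, IsOpen U → Constructible (f ⁻¹' U))
    (hbad : ∀ x ∈ G, ∀ O : Set Y, IsOpen O → f x ∈ O → x ∈ interior (closure (f ⁻¹' O))) :
    ContinuousOn f G := by
  intro x hx
  refine ContinuousAt.continuousWithinAt ?_
  refine (closed_nhds_basis (f x)).tendsto_right_iff.mpr fun C ⟨hCx, hC⟩ => ?_
  have hxC := hbad x hx (interior C) isOpen_interior (mem_interior_iff_mem_nhds.mpr hCx)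
  filter_upwards [isOpen_interior.mem_nhds hxC, hG.mem_nhds hx] with p hp hpG
  by_contra hpC
  have hpC' := hbad p hpG Cᶜ hC.isOpen_compl hpC
  have hsub : interior (closure (f ⁻¹' interior C)) ∩ interior (closure (f ⁻¹' Cᶜ)) ⊆
      frontier (f ⁻¹' Cᶜ) := by
    rintro z ⟨hz, hz'⟩
    refine ⟨interior_subset hz', fun hzint => ?_⟩
    obtain ⟨w, hw, hw'⟩ := mem_closure_iff.mp (interior_subset hz) _ isOpen_interior hzint
    exact interior_subset hw (interior_subset (s := C) hw')
  have hmem := interior_maximal hsub (isOpen_interior.inter isOpen_interior) ⟨hp, hpC'⟩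
  rwa [(hmeas _ hC.isOpen_compl).interior_frontier_eq_empty] at hmem

theorem IsClosedMap.exists_isOpen_preimage_eq {f : X → Y} (hclosed : IsClosedMap f)
    (hinj : Function.Injective f) {V : Set X} (hV : IsOpen V) :
    ∃ O : Set Y, IsOpen O ∧ f ⁻¹' O = V :=
  ⟨(f '' Vᶜ)ᶜ, (hclosed _ hV.isClosed_compl).isOpen_compl, by
    rw [preimage_compl, hinj.preimage_image, compl_compl]⟩

end Oscillation

/-- If `closure (W p)` is not a neighbourhood of `p` for a dense set of points `p`, then a
relatively discrete family of such points is approximated by another one avoiding the sets `W`. -/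
theorem exists_next_discrete_family {X : Type*} [PseudoMetricSpace X] {D : Set X} (hD : Dense D)
    {W : X → Set X} (hW : ∀ x ∈ D, x ∈ W x ∧ x ∉ interior (closure (W x)))
    {P : Set X} {V : X → Set X} (hPD : P ⊆ D) (hne : P.Nonempty)
    (hV : ∀ p ∈ P, IsOpen (V p) ∧ p ∈ V p) (hdisj : P.PairwiseDisjoint V) :
    ∃ (P' : Set X) (V' : X → Set X), (P' ⊆ D ∧ P'.Nonempty ∧
      (∀ p ∈ P', IsOpen (V' p) ∧ p ∈ V' p) ∧ P'.PairwiseDisjoint V') ∧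
      (⋃ p ∈ P', V' p) ⊆ (⋃ p ∈ P, V p) \ (⋃ p ∈ P, V p ∩ W p) ∧ P ⊆ closure P' := by
  set E := ⋃ p ∈ P, V p ∩ W p
  have hPE : P ⊆ E := fun p hp => mem_biUnion hp ⟨(hV p hp).2, (hW p (hPD hp)).1⟩
  have hopen : IsOpen ((⋃ p ∈ P, V p) \ closure E) :=
    (isOpen_biUnion fun p hp => (hV p hp).1).sdiff isClosed_closure
  have hcl : P ⊆ closure ((⋃ p ∈ P, V p) \ closure E) := by
    intro p hp
    refine mem_closure_iff.mpr fun N hN hpN => ?_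
    have hp' : p ∈ closure (closure (W p))ᶜ := by
      rw [closure_compl]
      exact (hW p (hPD hp)).2
    obtain ⟨y, ⟨hyN, hyV⟩, hyW⟩ :=
      mem_closure_iff.mp hp' _ (hN.inter (hV p hp).1) ⟨hpN, (hV p hp).2⟩
    refine ⟨y, hyN, mem_biUnion hp hyV, fun hyE => ?_⟩
    obtain ⟨z, ⟨hzV, hzW⟩, hzE⟩ :=
      mem_closure_iff.mp hyE _ ((hV p hp).1.sdiff isClosed_closure) ⟨hyV, hyW⟩
    obtain ⟨q, hq, hzq⟩ := mem_iUnion₂.mp hzE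
    obtain rfl : p = q := hdisj.elim hp hq (not_disjoint_iff.mpr ⟨z, hzV, hzq.1⟩)
    exact hzW (subset_closure hzq.2)
  obtain ⟨P', V', hP'D, hV', hdisj', hcl'⟩ := exists_pairwiseDisjoint_isOpen_subset_closure
    hopen hD (fun p hp => ⟨hcl hp, fun h => h.2 (subset_closure (hPE hp))⟩) hne
  refine ⟨P', V', ⟨hP'D, closure_nonempty_iff.mp (hne.mono hcl'),
    fun p hp => ⟨(hV' p hp).1, (hV' p hp).2.1⟩, hdisj'⟩, ?_, hcl'⟩
  exact iUnion₂_subset fun p hp =>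
    (hV' p hp).2.2.trans (sdiff_subset_sdiff_right subset_closure)

/-- A closed injective constructible-measurable map is continuous on some nonempty open set. -/
theorem exists_isOpen_nonempty_continuousOn {X Y : Type*} [PseudoMetricSpace X] [Nonempty X]
    [TopologicalSpace Y] [RegularSpace Y] {f : X → Y} (hinj : Function.Injective f)
    (hclosed : IsClosedMap f) (hmeas : ∀ U : Set Y, IsOpen U → Constructible (f ⁻¹' U)) :
    ∃ G : Set X, IsOpen G ∧ G.Nonempty ∧ ContinuousOn f G := by
  by_contra! hdisc
  set D : Set X := {x | ∃ O : Set Y, IsOpen O ∧ f x ∈ O ∧ x ∉ interior (closure (f ⁻¹' O))}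
  have hD : Dense D := by
    refine dense_iff_inter_open.mpr fun G hG hne => ?_
    by_contra! hempty
    refine hdisc G hG hne (continuousOn_of_mem_interior_closure_preimage hG hmeas ?_)
    intro x hx O hO hxO
    by_contra hxint
    exact (hempty ▸ (⟨hx, O, hO, hxO, hxint⟩ : x ∈ G ∩ D) : x ∈ (∅ : Set X))
  have hchoice : ∀ x, ∃ O : Set Y, x ∈ D →
      IsOpen O ∧ f x ∈ O ∧ x ∉ interior (closure (f ⁻¹' O)) := fun x => by
    by_cases hx : x ∈ D
    · exact hx.imp fun O hO _ => hO
    · exact ⟨∅, fun h => absurd h hx⟩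
  choose O hO using hchoice
  set W : X → Set X := fun x => f ⁻¹' O x
  have hW : ∀ x ∈ D, x ∈ W x ∧ x ∉ interior (closure (W x)) := fun x hx => (hO x hx).2
  let S := {s : Set X × (X → Set X) // s.1 ⊆ D ∧ s.1.Nonempty ∧
    (∀ p ∈ s.1, IsOpen (s.2 p) ∧ p ∈ s.2 p) ∧ s.1.PairwiseDisjoint s.2}
  have hstep : ∀ s : S, ∃ t : S, (⋃ p ∈ t.1.1, t.1.2 p) ⊆
      (⋃ p ∈ s.1.1, s.1.2 p) \ (⋃ p ∈ s.1.1, s.1.2 p ∩ W p) ∧ s.1.1 ⊆ closure t.1.1 := by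
    rintro ⟨⟨P, V⟩, hPD, hne, hV, hdisj⟩
    obtain ⟨P', V', h, h'⟩ := exists_next_discrete_family hD hW hPD hne hV hdisj
    exact ⟨⟨(P', V'), h⟩, h'⟩
  choose next hnext using hstep
  obtain ⟨x₀, hx₀⟩ := hD.nonempty
  let s₀ : S := ⟨({x₀}, fun _ => univ), by simpa using hx₀, by simp, by simp, by simp⟩
  let s : ℕ → S := fun n => next^[n] s₀
  have hs : ∀ n, s (n + 1) = next (s n) := fun n => Function.iterate_succ_apply' next n s₀
  let U : ℕ → Set X := fun n => ⋃ p ∈ (s n).1.1, (s n).1.2 p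
  let E : ℕ → Set X := fun n => ⋃ p ∈ (s n).1.1, (s n).1.2 p ∩ W p
  have hsucc : ∀ n, U (n + 1) ⊆ U n \ E n := fun n => by
    simp only [U, E, hs]
    exact (hnext (s n)).1
  have hcl : ∀ n, (s n).1.1 ⊆ closure (s (n + 1)).1.1 := fun n => by
    rw [hs]
    exact (hnext (s n)).2
  have hU : Antitone U := antitone_nat_of_succ_le fun n => (hsucc n).trans sdiff_subset
  have hEU : ∀ n, E n ⊆ U n := fun n => iUnion₂_mono fun _ _ => inter_subset_left
  have hPE : ∀ n, (s n).1.1 ⊆ E n := fun n p hp =>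
    mem_biUnion hp ⟨((s n).2.2.2.1 p hp).2, (hW p ((s n).2.1 hp)).1⟩
  have hlt : ∀ m n, m < n → Disjoint (E m) (E n) := fun m n hmn =>
    disjoint_left.mpr fun x hm hn => (hsucc m (hU hmn (hEU n hn))).2 hm
  have hEdisj : ∀ m n, m ≠ n → Disjoint (E m) (E n) := fun m n hmn =>
    hmn.lt_or_gt.elim (hlt m n) fun h => (hlt n m h).symm
  have hEopen : ∀ n, ∃ B : Set Y, IsOpen B ∧ f ⁻¹' B = E n := by
    intro n
    refine isOpen_induced_iff.mp (@isOpen_biUnion _ _ (.induced f inferInstance) _ _ fun p hp => ?_)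
    obtain ⟨B, hB, hBV⟩ := hclosed.exists_isOpen_preimage_eq hinj ((s n).2.2.2.1 p hp).1
    exact isOpen_induced_iff.mpr ⟨B ∩ O p, hB.inter (hO p ((s n).2.1 hp)).1, by
      rw [preimage_inter, hBV]⟩
  choose B hB hBE using hEopen
  have hA : Constructible (⋃ n, E (2 * n)) := by
    have h := hmeas (⋃ n, B (2 * n)) (isOpen_iUnion fun n => hB _)
    simpa only [preimage_iUnion, hBE] using h
  have heven : ∀ n, Even n → (s n).1.1 ⊆ (⋃ n, (s n).1.1) ∩ ⋃ n, E (2 * n) := by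
    intro n hn p hp
    obtain ⟨k, rfl⟩ := even_iff_exists_two_mul.mp hn
    exact ⟨mem_iUnion_of_mem _ hp, mem_iUnion_of_mem k (hPE _ hp)⟩
  have hodd : ∀ n, ¬ Even n → (s n).1.1 ⊆ (⋃ n, (s n).1.1) \ ⋃ n, E (2 * n) := by
    intro n hn p hp
    refine ⟨mem_iUnion_of_mem _ hp, fun h => ?_⟩
    obtain ⟨k, hk⟩ := mem_iUnion.mp h
    refine disjoint_left.mp (hEdisj n (2 * k) ?_) (hPE n hp) hk
    rintro rfl
    exact hn (even_two_mul k)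
  refine hA.not_subset_closure_inter_and_diff (T := ⋃ n, (s n).1.1)
    ((s 0).2.2.1.mono (subset_iUnion (fun n => (s n).1.1) 0)) ?_ ?_ <;>
  refine iUnion_subset fun n => ?_ <;> by_cases hn : Even n
  · exact (heven n hn).trans subset_closure
  · exact (hcl n).trans (closure_mono (heven _ (by simpa [Nat.even_add_one] using hn)))
  · exact (hcl n).trans (closure_mono (hodd _ (by simpa [Nat.even_add_one] using hn)))
  · exact (hodd n hn).trans subset_closure

/-- `f` is piece-wise continuous on `S`, with pieces closed in the ambient space. -/
def PiecewiseContinuousOn {X Y : Type*} [TopologicalSpace X] [TopologicalSpace Y] (f : X → Y)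
    (S : Set X) : Prop :=
  ∃ Z : ℕ → Set X, (∀ n, IsClosed (Z n)) ∧ (⋃ n, Z n) = S ∧ ∀ n, ContinuousOn f (Z n)

namespace PiecewiseContinuousOn

variable {X Y ι : Type*} [TopologicalSpace X] [TopologicalSpace Y] {f : X → Y}

theorem iUnion [Countable ι] {S : ι → Set X} (h : ∀ i, PiecewiseContinuousOn f (S i)) :
    PiecewiseContinuousOn f (⋃ i, S i) := by
  rcases isEmpty_or_nonempty ι with hι | hι
  · exact ⟨fun _ => ∅, by simp, by simp, by simp⟩
  choose Z hZ hZS hZf using h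
  obtain ⟨e, he⟩ := exists_surjective_nat (ι × ℕ)
  refine ⟨fun n => Z (e n).1 (e n).2, fun n => hZ _ _, ?_, fun n => hZf _ _⟩
  rw [he.iUnion_comp fun q => Z q.1 q.2, iUnion_prod']
  exact iUnion_congr hZS

theorem union {S T : Set X} (hS : PiecewiseContinuousOn f S) (hT : PiecewiseContinuousOn f T) :
    PiecewiseContinuousOn f (S ∪ T) := by
  rw [union_eq_iUnion]
  exact iUnion (Bool.forall_bool.mpr ⟨hT, hS⟩)

theorem inter_isOpen [MetrizableSpace X] {S V : Set X} (hS : PiecewiseContinuousOn f S)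
    (hV : IsOpen V) : PiecewiseContinuousOn f (S ∩ V) := by
  let _ := metrizableSpaceMetric X
  obtain ⟨F, hF, -, hFV, -⟩ := hV.exists_iUnion_isClosed
  obtain ⟨Z, hZ, rfl, hZf⟩ := hS
  rw [← hFV, iUnion_inter_iUnion]
  exact iUnion fun m => iUnion fun n =>
    ⟨fun _ => Z m ∩ F n, fun _ => (hZ _).inter (hF _), iUnion_const _,
      fun _ => (hZf _).mono inter_subset_left⟩

end PiecewiseContinuousOn

theorem ContinuousOn.piecewiseContinuousOn_inter_isOpen {X Y : Type*} [TopologicalSpace X]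
    [TopologicalSpace Y] [MetrizableSpace X] {f : X → Y} {K V : Set X} (hK : IsClosed K)
    (hV : IsOpen V) (hf : ContinuousOn f (K ∩ V)) : PiecewiseContinuousOn f (K ∩ V) := by
  let _ := metrizableSpaceMetric X
  obtain ⟨F, hF, -, hFV, -⟩ := hV.exists_iUnion_isClosed
  refine ⟨fun n => K ∩ F n, fun n => hK.inter (hF n), by rw [← inter_iUnion, hFV], fun n => ?_⟩
  exact hf.mono (inter_subset_inter_right K (hFV ▸ subset_iUnion F n))

/-- Every one-to-one, closed, constructible-measurable surjection between separable
metrizable spaces is piece-wise continuous. -/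
theorem closed_constructibleMeasurable_bijection_is_piecewise_continuous
    {X Y : Type*} [TopologicalSpace X] [TopologicalSpace Y]
    [MetrizableSpace X] [SeparableSpace X]
    [MetrizableSpace Y] [SeparableSpace Y]
    (f : X → Y) (hinj : Function.Injective f) (hsurj : Function.Surjective f)
    (hclosed : IsClosedMap f)
    (hmeas : ∀ U : Set Y, IsOpen U → Constructible (f ⁻¹' U)) :
    ∃ Z : ℕ → Set X, (∀ n, IsClosed (Z n)) ∧ (⋃ n, Z n) = Set.univ ∧
      ∀ n, ContinuousOn f (Z n) := by
  let _ := metrizableSpaceMetric X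
  have : SecondCountableTopology X := UniformSpace.secondCountable_of_separable X
  obtain ⟨C, hCcount, hCsub, hCeq⟩ := isOpen_sUnion_countable
    {U : Set X | IsOpen U ∧ PiecewiseContinuousOn f U} fun U hU => hU.1
  set U₀ : Set X := ⋃₀ {U : Set X | IsOpen U ∧ PiecewiseContinuousOn f U}
  have hU₀open : IsOpen U₀ := isOpen_sUnion fun U hU => hU.1
  have hU₀pc : PiecewiseContinuousOn f U₀ := by
    have := hCcount.to_subtype
    rw [← hCeq, sUnion_eq_iUnion]
    exact .iUnion fun U : C => (hCsub U.2).2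
  suffices h : U₀ = univ by rwa [h] at hU₀pc
  by_contra hne
  have hK : IsClosed U₀ᶜ := hU₀open.isClosed_compl
  have : Nonempty ↥(U₀ᶜ) := (nonempty_compl.mpr hne).to_subtype
  obtain ⟨G, hG, ⟨x, hxG⟩, hfG⟩ := exists_isOpen_nonempty_continuousOn
    (f := fun x : ↥(U₀ᶜ) => f x) (hinj.comp Subtype.val_injective)
    (hclosed.comp hK.isClosedMap_subtype_val)
    fun U hU => (hmeas U hU).preimage continuous_subtype_val
  obtain ⟨V, hV, rfl⟩ := isOpen_induced_iff.mp hG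
  have hfV : ContinuousOn f (U₀ᶜ ∩ V) := by
    rw [← Subtype.image_preimage_coe]
    exact IsInducing.subtypeVal.continuousOn_image_iff.mpr hfG
  have hVpc : PiecewiseContinuousOn f V := by
    have h := (hU₀pc.inter_isOpen hV).union (hfV.piecewiseContinuousOn_inter_isOpen hK hV)
    rwa [← union_inter_distrib_right, union_compl_self, univ_inter] at h
  exact x.2 (mem_sUnion_of_mem hxG ⟨hV, hVpc⟩)
end

section
/- There exist subspaces I_X and I_Y of the Cantor space 2^ℕ that are Polish (i.e. each is a completely metrizable separable subspace, equivalently a Gδ subset of 2^ℕ) and a continuous open surjection f : I_X → I_Y such that: (1) there exists a base 𝓑 for the topology of I_X consisting of clopen sets with f(B) clopen in I_Y for every B ∈ 𝓑, and (2) f is not closed-Fσ, i.e. there exists a closed subset C of I_X whose image f(C) is not an Fσ subset of I_Y. -/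
open TopologicalSpace

/-- A set is Fσ if it is a countable union of closed sets. -/
def IsFsigma {Y : Type*} [TopologicalSpace Y] (S : Set Y) : Prop :=
  ∃ F : ℕ → Set Y, (∀ n, IsClosed (F n)) ∧ S = ⋃ n, F n

open Filter Topology

/-- The binary sequences that take the value `true` infinitely often. -/
def infinitelyOftenTrue : Set (ℕ → Bool) :=
  {x | ∀ n, ∃ m, n ≤ m ∧ x m = true}

/-- A set containing every sequence obtained from an arbitrary one by replacing a tail
with the constant `b` is dense. -/
theorem dense_of_forall_eventually_const_mem {s : Set (ℕ → Bool)} (b : Bool)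
    (h : ∀ (x : ℕ → Bool) (n : ℕ), (fun m => if m < n then x m else b) ∈ s) : Dense s := by
  intro x
  refine mem_closure_of_tendsto (f := fun n m => if m < n then x m else b) (b := atTop) ?_
    (Eventually.of_forall (h x))
  rw [tendsto_pi_nhds]
  intro m
  refine tendsto_const_nhds.congr' ?_
  filter_upwards [eventually_gt_atTop m] with n hn
  simp [hn]

theorem isGδ_infinitelyOftenTrue : IsGδ infinitelyOftenTrue := by
  have h : infinitelyOftenTrue = ⋂ n : ℕ, ⋃ m : ℕ, ⋃ _ : n ≤ m, {x | x m = true} := by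
    ext x
    simp [infinitelyOftenTrue]
  rw [h]
  refine IsGδ.iInter_of_isOpen fun n => isOpen_iUnion fun m => isOpen_iUnion fun _ => ?_
  exact isOpen_discrete ({true} : Set Bool) |>.preimage (continuous_apply (A := fun _ => Bool) m)

theorem dense_infinitelyOftenTrue : Dense infinitelyOftenTrue :=
  dense_of_forall_eventually_const_mem true fun _ n k =>
    ⟨max n k, le_max_right _ _, by simp⟩

theorem dense_compl_infinitelyOftenTrue : Dense infinitelyOftenTrueᶜ :=
  dense_of_forall_eventually_const_mem false fun _ n h => by
    obtain ⟨m, hm, hx⟩ := h n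
    simp [hm.not_gt] at hx

theorem not_isFsigma_infinitelyOftenTrue : ¬ IsFsigma infinitelyOftenTrue := by
  rintro ⟨F, hF, h⟩
  have hG : IsGδ infinitelyOftenTrueᶜ := by
    rw [h, Set.compl_iUnion]
    exact IsGδ.iInter_of_isOpen fun n => (hF n).isOpen_compl
  obtain ⟨x, hx, hx'⟩ := (dense_infinitelyOftenTrue.inter_of_Gδ isGδ_infinitelyOftenTrue hG
    dense_compl_infinitelyOftenTrue).nonempty
  exact hx' hx

theorem IsFsigma.preimage {X Y : Type*} [TopologicalSpace X] [TopologicalSpace Y] {s : Set Y}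
    (hs : IsFsigma s) {f : X → Y} (hf : Continuous f) : IsFsigma (f ⁻¹' s) := by
  obtain ⟨F, hF, rfl⟩ := hs
  exact ⟨fun n => f ⁻¹' F n, fun n => (hF n).preimage hf, Set.preimage_iUnion⟩

/-- Splitting a binary sequence into two binary sequences. -/
def cantorHomeomorphProd : (ℕ → Bool) ≃ₜ (ℕ → Bool) × (ℕ → Bool) :=
  (Homeomorph.piCongrLeft (Y := fun _ => Bool) Equiv.natSumNatEquivNat).symm.trans
    Homeomorph.sumArrowHomeomorphProdArrow

/-- There exist Polish (Gδ) subspaces `IX`, `IY` of the Cantor space `ℕ → Bool` and a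
continuous open surjection `f : IX → IY` taking the elements of some clopen base of
`IX` to clopen sets, such that `f` is not closed-Fσ. -/
theorem exists_open_clopenBase_not_closedFsigma :
    ∃ (IX IY : Set (ℕ → Bool)), IsGδ IX ∧ IsGδ IY ∧
      ∃ f : IX → IY, Continuous f ∧ IsOpenMap f ∧ Function.Surjective f ∧
        (∃ 𝓑 : Set (Set IX), IsTopologicalBasis 𝓑 ∧
          ∀ B ∈ 𝓑, IsClopen B ∧ IsClopen (f '' B)) ∧
        ∃ C : Set IX, IsClosed C ∧ ¬ IsFsigma (f '' C) := by
  set e := cantorHomeomorphProd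
  set G := infinitelyOftenTrue
  let φ : {x | (e x).2 ∈ G} → (ℕ → Bool) × (ℕ → Bool) := fun x => e x
  have hφ : IsInducing φ := e.isInducing.comp IsInducing.subtypeVal
  let f : {x | (e x).2 ∈ G} → (Set.univ : Set (ℕ → Bool)) := fun x => ⟨(φ x).1, trivial⟩
  have hf : Continuous f := (continuous_fst.comp hφ.continuous).subtype_mk _
  have lift : ∀ y, ∀ z ∈ G, ∃ x, φ x = (y, z) := fun y z hz =>
    ⟨⟨e.symm (y, z), by simpa using hz⟩, by simp [φ]⟩
  have basis := ((isTopologicalBasis_isClopen (X := ℕ → Bool)).prod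
    (isTopologicalBasis_isClopen (X := ℕ → Bool))).isInducing hφ
  have clopen : ∀ B ∈ Set.preimage φ '' Set.image2 (· ×ˢ ·) {s : Set (ℕ → Bool) | IsClopen s}
      {s : Set (ℕ → Bool) | IsClopen s}, IsClopen B ∧ IsClopen (f '' B) := by
    rintro _ ⟨_, ⟨U, hU, V, hV, rfl⟩, rfl⟩
    refine ⟨(hU.prod hV).preimage hφ.continuous, ?_⟩
    by_cases h : (V ∩ G).Nonempty
    · obtain ⟨z, hzV, hzG⟩ := h
      convert hU.preimage (continuous_subtype_val (p := (· ∈ (Set.univ : Set (ℕ → Bool)))))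
      ext y
      constructor
      · rintro ⟨x, hx, rfl⟩
        exact hx.1
      · intro hy
        obtain ⟨x, hx⟩ := lift y z hzG
        refine ⟨x, ?_, Subtype.ext (congrArg Prod.fst hx)⟩
        rw [Set.mem_preimage, hx]
        exact ⟨hy, hzV⟩
    · convert isClopen_empty
      refine Set.image_eq_empty.2 (Set.eq_empty_of_forall_notMem fun x hx => ?_)
      exact h ⟨(φ x).2, hx.2, x.2⟩
  refine ⟨{x | (e x).2 ∈ G}, Set.univ,
    isGδ_infinitelyOftenTrue.preimage (continuous_snd.comp e.continuous), IsGδ.univ, f, hf,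
    basis.isOpenMap_iff.2 fun B hB => (clopen B hB).2.isOpen, ?_, ⟨_, basis, clopen⟩,
    {x | (φ x).1 = (φ x).2}, isClosed_eq (continuous_fst.comp hφ.continuous)
      (continuous_snd.comp hφ.continuous), fun h => not_isFsigma_infinitelyOftenTrue ?_⟩
  · obtain ⟨z, hz⟩ := dense_infinitelyOftenTrue.nonempty
    intro y
    obtain ⟨x, hx⟩ := lift y z hz
    exact ⟨x, Subtype.ext (congrArg Prod.fst hx)⟩
  · convert h.preimage (f := fun y : ℕ → Bool => (⟨y, trivial⟩ : (Set.univ : Set (ℕ → Bool))))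
      (continuous_id.subtype_mk _)
    ext y
    constructor
    · intro hy
      obtain ⟨x, hx⟩ := lift y y hy
      exact ⟨x, by simp [hx], Subtype.ext (congrArg Prod.fst hx)⟩
    · rintro ⟨x, hx, hxy⟩
      have hy : (φ x).1 = y := congrArg Subtype.val hxy
      rw [← hy, show (φ x).1 = (φ x).2 from hx]
      exact x.2
end
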